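/- The identity ∫_ℝ Q'(x)² dx + ∫_ℝ Q(x)² dx = ∫_ℝ Q(x)^(p+1) dx holds. -/

import Mathlib

/-- The soliton profile `Q(x) = ((p+1)/(2 cosh²(((p−1)/2)x)))^(1/(p−1))`. -/
noncomputable def Q (p : ℕ) (x : ℝ) : ℝ :=
  (((p : ℝ) + 1) / (2 * Real.cosh ((((p : ℝ) - 1) / 2) * x) ^ 2)) ^ (1 / ((p : ℝ) - 1))

open MeasureTheory

lemma Q_pos (p : ℕ) (x : ℝ) : 0 < Q p x := by
  have := Real.cosh_pos ((((p : ℝ) - 1) / 2) * x)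
  unfold Q
  positivity

lemma Q_pow_sub_one {p : ℕ} (hp : 2 ≤ p) (x : ℝ) :
    Q p x ^ (p - 1) = ((p : ℝ) + 1) / (2 * Real.cosh ((((p : ℝ) - 1) / 2) * x) ^ 2) := by
  have h := Real.cosh_pos ((((p : ℝ) - 1) / 2) * x)
  have hp' : (2 : ℝ) ≤ p := by exact_mod_cast hp
  have hcast : ((p - 1 : ℕ) : ℝ) = (p : ℝ) - 1 := by
    rw [Nat.cast_sub (by omega), Nat.cast_one]
  unfold Q
  rw [← Real.rpow_natCast, ← Real.rpow_mul (by positivity), hcast,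
    one_div_mul_cancel (by linarith), Real.rpow_one]

lemma Q_pow_add_one {p : ℕ} (hp : 2 ≤ p) (x : ℝ) :
    Q p x ^ (p + 1) =
      ((p : ℝ) + 1) / (2 * Real.cosh ((((p : ℝ) - 1) / 2) * x) ^ 2) * Q p x ^ 2 := by
  rw [← Q_pow_sub_one hp, ← pow_add]
  congr 1
  omega

lemma hasDerivAt_Q {p : ℕ} (hp : 2 ≤ p) (x : ℝ) :
    HasDerivAt (Q p) (-Real.tanh ((((p : ℝ) - 1) / 2) * x) * Q p x) x := by
  have hp' : (2 : ℝ) ≤ p := by exact_mod_cast hp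
  have hp1 : (p : ℝ) - 1 ≠ 0 := by linarith
  have hc := Real.cosh_pos ((((p : ℝ) - 1) / 2) * x)
  have hlin : HasDerivAt (fun y : ℝ => (((p : ℝ) - 1) / 2) * y) (((p : ℝ) - 1) / 2) x := by
    simpa using (hasDerivAt_id x).const_mul (((p : ℝ) - 1) / 2)
  have hbase := (hasDerivAt_const x ((p : ℝ) + 1)).fun_div
    ((hlin.cosh.fun_pow 2).const_mul 2) (by positivity)
  have h := hbase.rpow_const (p := 1 / ((p : ℝ) - 1)) (Or.inl (by positivity))
  refine h.congr_deriv ?_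
  rw [Real.rpow_sub_one (by positivity)]
  change _ * _ * (Q p x / _) = _
  rw [Real.tanh_eq_sinh_div_cosh]
  field_simp
  ring

lemma Q_le {p : ℕ} (hp : 2 ≤ p) (x : ℝ) :
    Q p x ≤ (2 * ((p : ℝ) + 1)) ^ (1 / ((p : ℝ) - 1)) * Real.exp (-|x|) := by
  have hp' : (2 : ℝ) ≤ p := by exact_mod_cast hp
  have hp1 : (p : ℝ) - 1 ≠ 0 := by linarith
  have hexp : Real.exp (-|x|) = Real.exp (-(((p : ℝ) - 1) * |x|)) ^ (1 / ((p : ℝ) - 1)) := by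
    rw [← Real.exp_mul]
    congr 1
    field_simp
  have hcosh : Real.exp ((((p : ℝ) - 1) / 2) * |x|) / 2 ≤
      Real.cosh ((((p : ℝ) - 1) / 2) * x) := by
    rw [← Real.cosh_abs, abs_mul, abs_of_pos (by linarith : 0 < ((p : ℝ) - 1) / 2), Real.cosh_eq]
    linarith [Real.exp_pos (-((((p : ℝ) - 1) / 2) * |x|))]
  have hsq : Real.exp ((((p : ℝ) - 1) / 2) * |x|) ^ 2 = Real.exp (((p : ℝ) - 1) * |x|) := by
    rw [← Real.exp_nat_mul]
    congr 1
    push_cast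
    ring
  have hc := Real.cosh_pos ((((p : ℝ) - 1) / 2) * x)
  rw [hexp, ← Real.mul_rpow (by positivity) (by positivity)]
  unfold Q
  refine Real.rpow_le_rpow (by positivity) ?_ (one_div_nonneg.2 (by linarith))
  calc ((p : ℝ) + 1) / (2 * Real.cosh ((((p : ℝ) - 1) / 2) * x) ^ 2)
      ≤ ((p : ℝ) + 1) / (2 * (Real.exp ((((p : ℝ) - 1) / 2) * |x|) / 2) ^ 2) := by gcongr
    _ = 2 * ((p : ℝ) + 1) * Real.exp (-(((p : ℝ) - 1) * |x|)) := by
      rw [div_pow, hsq, Real.exp_neg]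
      field_simp

lemma exp_neg_abs_sq_le (x : ℝ) : Real.exp (-|x|) ^ 2 ≤ (1 + x ^ 2)⁻¹ := by
  rw [Real.exp_neg, inv_pow]
  gcongr
  nlinarith [Real.add_one_le_exp |x|, abs_nonneg x, sq_abs x]

lemma continuous_Q {p : ℕ} (hp : 2 ≤ p) : Continuous (Q p) :=
  continuous_iff_continuousAt.2 fun x => (hasDerivAt_Q hp x).continuousAt

lemma integrable_Q_sq {p : ℕ} (hp : 2 ≤ p) : Integrable fun x => Q p x ^ 2 := by
  refine (integrable_inv_one_add_sq.const_mul
    (((2 * ((p : ℝ) + 1)) ^ (1 / ((p : ℝ) - 1))) ^ 2)).mono'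
    ((continuous_Q hp).pow 2).aestronglyMeasurable (Filter.Eventually.of_forall fun x => ?_)
  rw [Real.norm_of_nonneg (by positivity)]
  calc Q p x ^ 2 ≤ ((2 * ((p : ℝ) + 1)) ^ (1 / ((p : ℝ) - 1)) * Real.exp (-|x|)) ^ 2 :=
        pow_le_pow_left₀ (Q_pos p x).le (Q_le hp x) 2
    _ ≤ _ := by
        rw [mul_pow]
        gcongr
        exact exp_neg_abs_sq_le x

lemma continuous_tanh_mul (a : ℝ) : Continuous fun x : ℝ => Real.tanh (a * x) := by
  simp only [Real.tanh_eq_sinh_div_cosh]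
  exact (Real.continuous_sinh.comp (continuous_const_mul a)).div
    (Real.continuous_cosh.comp (continuous_const_mul a)) fun x => (Real.cosh_pos _).ne'

lemma tanh_sq_add_inv_cosh_sq (y : ℝ) : Real.tanh y ^ 2 + 1 / Real.cosh y ^ 2 = 1 := by
  have hc := Real.cosh_pos y
  rw [Real.tanh_eq_sinh_div_cosh, div_pow, ← add_div, ← Real.cosh_sq, div_self (by positivity)]

/-- Identity: `∫ Q'² + ∫ Q² = ∫ Q^(p+1)`. -/
theorem stmt5 (p : ℕ) (hp : 2 ≤ p) :
    (∫ x : ℝ, deriv (Q p) x ^ 2) + (∫ x : ℝ, Q p x ^ 2) = ∫ x : ℝ, Q p x ^ (p + 1) := by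
  set a : ℝ := ((p : ℝ) - 1) / 2 with ha
  have hQ := integrable_Q_sq hp
  have htanh := continuous_tanh_mul a
  have hbound (x : ℝ) : Real.tanh (a * x) ^ 2 ≤ 1 := by
    have h := tanh_sq_add_inv_cosh_sq (a * x)
    have : 0 ≤ 1 / Real.cosh (a * x) ^ 2 := by positivity
    linarith
  have hflux : Integrable fun x => -Real.tanh (a * x) * Q p x ^ 2 :=
    hQ.bdd_mul (c := 1) htanh.neg.aestronglyMeasurable (Filter.Eventually.of_forall fun x => by
      rw [norm_neg, Real.norm_eq_abs]
      exact (sq_le_one_iff_abs_le_one _).1 (hbound x))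
  have hderiv_sq : Integrable fun x => deriv (Q p) x ^ 2 := by
    simp only [(hasDerivAt_Q hp _).deriv, ← ha, mul_pow, neg_sq]
    exact hQ.bdd_mul (c := 1) (htanh.pow 2).aestronglyMeasurable
      (Filter.Eventually.of_forall fun x => by
        rw [Real.norm_of_nonneg (by positivity)]
        exact hbound x)
  have hident (x : ℝ) : HasDerivAt (fun x => -Real.tanh (a * x) * Q p x ^ 2)
      (deriv (Q p) x ^ 2 + Q p x ^ 2 - Q p x ^ (p + 1)) x := by
    have hc := Real.cosh_pos (a * x)
    have hlin : HasDerivAt (fun y : ℝ => a * y) a x := by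
      simpa using (hasDerivAt_id x).const_mul a
    have h := ((hlin.sinh.fun_div hlin.cosh hc.ne').fun_neg).fun_mul ((hasDerivAt_Q hp x).fun_pow 2)
    simp only [← Real.tanh_eq_sinh_div_cosh] at h
    refine h.congr_deriv ?_
    have hp_eq : (p : ℝ) = 2 * a + 1 := by rw [ha]; ring
    rw [(hasDerivAt_Q hp x).deriv, Q_pow_add_one hp, ← ha, Real.tanh_eq_sinh_div_cosh, hp_eq]
    field_simp
    simp only [Real.sinh_sq]
    ring
  have hpow : Integrable fun x => Q p x ^ (p + 1) := by
    have hp' : (2 : ℝ) ≤ p := by exact_mod_cast hp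
    simp only [Q_pow_add_one hp]
    refine hQ.bdd_mul (c := (p : ℝ) + 1) ?_ (Filter.Eventually.of_forall fun x => ?_)
    · simp only [← Q_pow_sub_one hp]
      exact ((continuous_Q hp).pow _).aestronglyMeasurable
    · rw [Real.norm_of_nonneg (by positivity)]
      refine div_le_self (by positivity) ?_
      nlinarith [Real.one_le_cosh (((p : ℝ) - 1) / 2 * x)]
  have hsum : Integrable fun x => deriv (Q p) x ^ 2 + Q p x ^ 2 := hderiv_sq.add hQ
  have h := integral_eq_zero_of_hasDerivAt_of_integrable hident (hsum.sub hpow) hflux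
  rw [integral_sub hsum hpow, integral_add hderiv_sq hQ] at h
  linarith
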